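/- arXiv:2503.06180 — 2 statements merged into one kernel-verified Lean document; each statement's English description precedes it below -/
import Mathlib

section
/- Let ν be a measure on ℝⁿ and F ⊆ [n]. Then: (1) T_F(ν) = ν if and only if δ_J⊛ν = 0 for every J ⊆ [n] with |J ∩ F| odd; and (2) T_F(ν) = −ν if and only if δ_J⊛ν = 0 for every J ⊆ [n] with |J ∩ F| even. -/
open MeasureTheory
open scoped ENNReal symmDiff Classical

noncomputable section

/-- The Euclidean (ℓ²) norm on `Fin n → ℝ`. -/
def e2 {n : ℕ} (x : Fin n → ℝ) : ℝ := Real.sqrt (∑ i, (x i) ^ 2)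

/-- The unit sphere `S^{n-1}` in `ℝⁿ`. -/
def Sph (n : ℕ) : Set (Fin n → ℝ) := {x | e2 x = 1}

/-- The set `A_E = {x : xᵢ ≠ 0 ↔ i ∈ E}`. -/
def setA {n : ℕ} (E : Finset (Fin n)) : Set (Fin n → ℝ) := {x | ∀ i, x i ≠ 0 ↔ i ∈ E}

/-- Finite signed Borel measures on `ℝⁿ`. -/
abbrev SM (n : ℕ) := MeasureTheory.SignedMeasure (Fin n → ℝ)

/-- A (finite) measure regarded as a signed measure (junk value `0` if not finite). -/
def toSigned {X : Type*} [MeasurableSpace X] (ρ : Measure X) : SignedMeasure X :=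
  if h : IsFiniteMeasure ρ then @Measure.toSignedMeasure X _ ρ h else 0

/-- Multiplicative convolution of two non-negative measures. -/
def mconvPos {n : ℕ} (ρ σ : Measure (Fin n → ℝ)) : Measure (Fin n → ℝ) :=
  (ρ.prod σ).map (fun p => p.1 * p.2)

/-- Multiplicative convolution `μ ⊛ ν` of two signed measures, via Jordan decomposition. -/
def mconv {n : ℕ} (μ ν : SM n) : SM n :=
  toSigned (mconvPos μ.toJordanDecomposition.posPart ν.toJordanDecomposition.posPart
      + mconvPos μ.toJordanDecomposition.negPart ν.toJordanDecomposition.negPart)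
  - toSigned (mconvPos μ.toJordanDecomposition.posPart ν.toJordanDecomposition.negPart
      + mconvPos μ.toJordanDecomposition.negPart ν.toJordanDecomposition.posPart)

/-- `μ` is integrable: `∫ ‖x‖₂ d|μ| < ∞`. -/
def IntegrableSM {n : ℕ} (μ : SM n) : Prop :=
  ∫⁻ x, ENNReal.ofReal (e2 x) ∂μ.totalVariation < ⊤

/-- `μ` is concentrated on `A`:  `|μ|(Aᶜ) = 0`. -/
def ConcOn {n : ℕ} (μ : SM n) (A : Set (Fin n → ℝ)) : Prop := μ.totalVariation Aᶜ = 0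

/-- The multiple reflection `T_E` on `ℝⁿ`. -/
def flipE {n : ℕ} (E : Finset (Fin n)) (x : Fin n → ℝ) : Fin n → ℝ :=
  fun i => if i ∈ E then -x i else x i

/-- Pushforward of a signed measure under `T_E`. -/
def Tmap {n : ℕ} (E : Finset (Fin n)) (μ : SM n) : SM n := μ.map (flipE E)

def EvenUnder {n : ℕ} (μ : SM n) (E : Finset (Fin n)) : Prop := Tmap E μ = μ
def OddUnder {n : ℕ} (μ : SM n) (E : Finset (Fin n)) : Prop := Tmap E μ = -μ

/-- Orthogonal projection onto the coordinate subspace `H_E`. -/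
def projE {n : ℕ} (E : Finset (Fin n)) (x : Fin n → ℝ) : Fin n → ℝ :=
  fun i => if i ∈ E then x i else 0

/-- `P_E(μ)`: pushforward under `projE`. -/
def Pmap {n : ℕ} (E : Finset (Fin n)) (μ : SM n) : SM n := μ.map (projE E)

/-- `R_E(μ) = μ_E`: restriction to `A_E`. -/
def Rres {n : ℕ} (E : Finset (Fin n)) (μ : SM n) : SM n := μ.restrict (setA E)

/-- Sign vector attached to `b : Fin n → Bool`. -/
def signVec {n : ℕ} (b : Fin n → Bool) : Fin n → ℝ := fun i => if b i then 1 else -1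

/-- The measure `δ_J = 2^{-n} ∑_{s ∈ 𝒮ⁿ} σ_J(s) δ_s`. -/
def deltaJ {n : ℕ} (J : Finset (Fin n)) : SM n :=
  ((2 : ℝ) ^ n)⁻¹ •
    ∑ b : Fin n → Bool,
      (∏ j ∈ J, (if b j then (1 : ℝ) else -1)) • toSigned (Measure.dirac (signVec b))

/-- `𝒥(E; Fe, Fo)`. -/
def JsetE {n : ℕ} (E : Finset (Fin n)) (Fe Fo : Set (Finset (Fin n))) :
    Set (Finset (Fin n)) :=
  {J | J ⊆ E ∧ (∀ F ∈ Fe, Even (J ∩ F).card) ∧ (∀ F ∈ Fo, Odd (J ∩ F).card)}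

/-- `𝒥(Fe, Fo) = 𝒥([n]; Fe, Fo)`. -/
def Jset {n : ℕ} (Fe Fo : Set (Finset (Fin n))) : Set (Finset (Fin n)) :=
  {J | (∀ F ∈ Fe, Even (J ∩ F).card) ∧ (∀ F ∈ Fo, Odd (J ∩ F).card)}

/-- `G` has a representation `G = F₁ Δ … Δ F_m` with each `Fᵢ` drawn from `Fe` or `Fo`,
in which the number of terms drawn from `Fo` is even (`odd = false`) or odd (`odd = true`). -/
def HasRep {n : ℕ} (Fe Fo : Set (Finset (Fin n))) (G : Finset (Fin n)) (odd : Bool) : Prop :=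
  ∃ l : List (Finset (Fin n) × Bool),
    (∀ p ∈ l, if p.2 then p.1 ∈ Fo else p.1 ∈ Fe) ∧
    (l.map Prod.fst).foldr (· ∆ ·) ∅ = G ∧
    (l.countP (fun p => p.2)) % 2 = (if odd then 1 else 0)

/-- The generating pair `(Fe, Fo)` is proper: the even and odd parts of the generated group
are disjoint. -/
def ProperPair {n : ℕ} (Fe Fo : Set (Finset (Fin n))) : Prop :=
  ∀ G : Finset (Fin n), ¬ (HasRep Fe Fo G false ∧ HasRep Fe Fo G true)

/-- `ℳ^int(A; Fe, Fo)`: integrable signed measures concentrated on `A`, even under `T_F`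
for `F ∈ Fe` and odd under `T_F` for `F ∈ Fo`. -/
def MclassInt {n : ℕ} (A : Set (Fin n → ℝ)) (Fe Fo : Set (Finset (Fin n))) : Set (SM n) :=
  {μ | IntegrableSM μ ∧ ConcOn μ A ∧ (∀ F ∈ Fe, EvenUnder μ F) ∧ (∀ F ∈ Fo, OddUnder μ F)}

/-- `ν` is universal on `𝒜`. -/
def Universal {n : ℕ} (ν : SM n) (𝒜 : Set (SM n)) : Prop :=
  ∀ μ ∈ 𝒜, mconv ν μ = 0 → μ = 0

/-- Radial projection of a non-negative measure. -/
def radPos {n : ℕ} (ρ : Measure (Fin n → ℝ)) : Measure (Fin n → ℝ) :=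
  (ρ.withDensity fun x => ENNReal.ofReal (e2 x)).map (fun x => (e2 x)⁻¹ • x)

/-- Radial projection `P_S` of a signed measure. -/
def PS {n : ℕ} (μ : SM n) : SM n :=
  toSigned (radPos μ.toJordanDecomposition.posPart) -
    toSigned (radPos μ.toJordanDecomposition.negPart)

/-- The spherical product `μ ⊛_S ν = P_S(μ ⊛ ν)`. -/
def mconvS {n : ℕ} (μ ν : SM n) : SM n := PS (mconv μ ν)

/-- `ν` is spherically universal on `𝒜`. -/
def SphUniversal {n : ℕ} (ν : SM n) (𝒜 : Set (SM n)) : Prop :=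
  ∀ μ ∈ 𝒜, mconvS ν μ = 0 → μ = 0

/-- The unconditional symmetrisation `M_unc`. -/
def Munc {n : ℕ} (μ : SM n) : SM n := ((2 : ℝ) ^ n)⁻¹ • ∑ E : Finset (Fin n), Tmap E μ

/-- Integral of `f` against a signed measure. -/
def sInt {n : ℕ} (μ : SM n) (f : (Fin n → ℝ) → ℝ) : ℝ :=
  (∫ x, f x ∂μ.toJordanDecomposition.posPart) - ∫ x, f x ∂μ.toJordanDecomposition.negPart

/-- `δ₁ ⊗ μ`: the lifting of `μ` to a measure on `ℝ^{n+1}`, with an extra `0`-th coordinate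
carrying a unit atom at `1`. -/
def lift0 {n : ℕ} (μ : SM n) : SM (n + 1) := μ.map (fun x => Fin.cons 1 x)

/-- Symmetrisation about the origin. -/
def Msym {n : ℕ} (μ : SM n) : SM n := (2 : ℝ)⁻¹ • (μ + μ.map (fun x => -x))

/-- The lifting `L(μ) = P_S(M_sym(δ₁ ⊗ μ))`. -/
def Lift {n : ℕ} (μ : SM n) : SM (n + 1) := PS (Msym (lift0 μ))

lemma toSigned_apply {X : Type*} [MeasurableSpace X] (ρ : Measure X) [h : IsFiniteMeasure ρ]
    {A : Set X} (hA : MeasurableSet A) : toSigned ρ A = ρ.real A := by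
  rw [toSigned, dif_pos h, Measure.toSignedMeasure_apply_measurable hA]

lemma measureReal_sum_measure {X ι : Type*} [MeasurableSpace X] (t : Finset ι)
    (ρ : ι → Measure X) [∀ i, IsFiniteMeasure (ρ i)] (A : Set X) :
    (∑ i ∈ t, ρ i).real A = ∑ i ∈ t, (ρ i).real A := by
  rw [measureReal_def, Measure.finsetSum_apply, ENNReal.toReal_sum fun i _ => measure_ne_top _ _]
  rfl

lemma measurable_pi_mul_pair {n : ℕ} :
    Measurable (fun p : (Fin n → ℝ) × (Fin n → ℝ) => p.1 * p.2) := by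
  fun_prop

instance isFiniteMeasure_mconvPos {n : ℕ} (ρ σ : Measure (Fin n → ℝ)) [IsFiniteMeasure ρ]
    [IsFiniteMeasure σ] : IsFiniteMeasure (mconvPos ρ σ) := by
  unfold mconvPos; infer_instance

/-- The value at `A` of the multiplicative convolution of a positive measure with `ν`. -/
def mconvLeft {n : ℕ} (ν : SM n) (A : Set (Fin n → ℝ)) (ρ : Measure (Fin n → ℝ)) : ℝ :=
  (mconvPos ρ ν.toJordanDecomposition.posPart).real A -
    (mconvPos ρ ν.toJordanDecomposition.negPart).real A

lemma mconv_apply {n : ℕ} (μ ν : SM n) {A : Set (Fin n → ℝ)} (hA : MeasurableSet A) :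
    mconv μ ν A = mconvLeft ν A μ.toJordanDecomposition.posPart -
      mconvLeft ν A μ.toJordanDecomposition.negPart := by
  rw [mconv, _root_.sub_apply, toSigned_apply _ hA, toSigned_apply _ hA,
    measureReal_add_apply, measureReal_add_apply]
  simp only [mconvLeft]
  ring

lemma mconvLeft_add {n : ℕ} (ν : SM n) (A : Set (Fin n → ℝ)) (ρ ρ' : Measure (Fin n → ℝ))
    [IsFiniteMeasure ρ] [IsFiniteMeasure ρ'] :
    mconvLeft ν A (ρ + ρ') = mconvLeft ν A ρ + mconvLeft ν A ρ' := by
  have key (σ : Measure (Fin n → ℝ)) [IsFiniteMeasure σ] :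
      (mconvPos (ρ + ρ') σ).real A = (mconvPos ρ σ).real A + (mconvPos ρ' σ).real A := by
    rw [← measureReal_add_apply, mconvPos, Measure.add_prod,
      Measure.map_add _ _ measurable_pi_mul_pair]
    rfl
  simp only [mconvLeft, key]
  ring

lemma mconvLeft_zero {n : ℕ} (ν : SM n) (A : Set (Fin n → ℝ)) : mconvLeft ν A 0 = 0 := by
  simp [mconvLeft, mconvPos]

lemma mconvLeft_sum {n : ℕ} {ι : Type*} (ν : SM n) (A : Set (Fin n → ℝ)) (t : Finset ι)
    (ρ : ι → Measure (Fin n → ℝ)) [∀ i, IsFiniteMeasure (ρ i)] :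
    mconvLeft ν A (∑ i ∈ t, ρ i) = ∑ i ∈ t, mconvLeft ν A (ρ i) := by
  induction t using Finset.induction_on with
  | empty => simp [mconvLeft_zero]
  | insert i t hi ih =>
    rw [Finset.sum_insert hi, Finset.sum_insert hi, mconvLeft_add, ih]

lemma mconvLeft_smul_dirac {n : ℕ} (ν : SM n) {A : Set (Fin n → ℝ)} (hA : MeasurableSet A)
    (r : ℝ) (s : Fin n → ℝ) :
    mconvLeft ν A (ENNReal.ofReal r • Measure.dirac s) = max r 0 * ν.map (s * ·) A := by
  have hs : Measurable (fun x : Fin n → ℝ => s * x) := by fun_prop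
  have key (σ : Measure (Fin n → ℝ)) [IsFiniteMeasure σ] :
      (mconvPos (ENNReal.ofReal r • Measure.dirac s) σ).real A =
        max r 0 * σ.real ((s * ·) ⁻¹' A) := by
    rw [mconvPos, Measure.prod_smul_left, Measure.map_smul, Measure.dirac_prod,
      Measure.map_map measurable_pi_mul_pair measurable_prodMk_left, measureReal_ennreal_smul_apply,
      ENNReal.toReal_ofReal']
    congr 1
    exact map_measureReal_apply hs hA
  rw [mconvLeft, key, key, VectorMeasure.map_apply _ hs hA,
    ν.apply_eq_posPart_real_sub_negPart_real (hs hA)]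
  ring

/-- Convolution only depends on the signed measure on the left, not on its chosen decomposition. -/
lemma mconv_toSigned_sub {n : ℕ} (p q : Measure (Fin n → ℝ)) [IsFiniteMeasure p]
    [IsFiniteMeasure q] (ν : SM n) {A : Set (Fin n → ℝ)} (hA : MeasurableSet A) :
    mconv (toSigned p - toSigned q) ν A = mconvLeft ν A p - mconvLeft ν A q := by
  rw [mconv_apply _ _ hA]
  set μ : SM n := toSigned p - toSigned q with hμ
  have h : μ.toJordanDecomposition.posPart + q = p + μ.toJordanDecomposition.negPart := by
    rw [← Measure.toSignedMeasure_eq_toSignedMeasure_iff]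
    have h1 := μ.toSignedMeasure_toJordanDecomposition
    rw [JordanDecomposition.toSignedMeasure] at h1
    rw [Measure.toSignedMeasure_add, Measure.toSignedMeasure_add]
    have hp : toSigned p = p.toSignedMeasure := dif_pos ‹_›
    have hq : toSigned q = q.toSignedMeasure := dif_pos ‹_›
    refine sub_eq_sub_iff_add_eq_add.mp ?_
    rw [h1, hμ, hp, hq]
  have h2 := congrArg (mconvLeft ν A) h
  rw [mconvLeft_add, mconvLeft_add] at h2
  linarith

lemma mconv_sum_smul_dirac {n : ℕ} {ι : Type*} [Fintype ι] (w : ι → ℝ) (s : ι → Fin n → ℝ)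
    (ν : SM n) :
    mconv (∑ i, w i • toSigned (Measure.dirac (s i))) ν = ∑ i, w i • ν.map (s i * ·) := by
  have hfin (r : ℝ) (x : Fin n → ℝ) :
      IsFiniteMeasure (ENNReal.ofReal r • Measure.dirac x) :=
    Measure.smul_finite _ ENNReal.ofReal_ne_top
  have hmax (r : ℝ) : max r 0 - max (-r) 0 = r := by
    rcases le_total r 0 with h | h <;> simp [h]
  have hdecomp : ∑ i, w i • toSigned (Measure.dirac (s i)) =
      toSigned (∑ i, ENNReal.ofReal (w i) • Measure.dirac (s i)) -
        toSigned (∑ i, ENNReal.ofReal (-w i) • Measure.dirac (s i)) := by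
    ext A hA
    rw [_root_.sub_apply, toSigned_apply _ hA, toSigned_apply _ hA, measureReal_sum_measure,
      measureReal_sum_measure, ← Finset.sum_sub_distrib, FunLike.coe_sum, Finset.sum_apply]
    refine Finset.sum_congr rfl fun i _ => ?_
    rw [_root_.smul_apply, toSigned_apply _ hA, measureReal_ennreal_smul_apply,
      measureReal_ennreal_smul_apply, ENNReal.toReal_ofReal', ENNReal.toReal_ofReal', ← sub_mul,
      hmax, smul_eq_mul]
  rw [hdecomp]
  ext A hA
  rw [mconv_toSigned_sub _ _ _ hA, mconvLeft_sum, mconvLeft_sum, ← Finset.sum_sub_distrib,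
    FunLike.coe_sum, Finset.sum_apply]
  refine Finset.sum_congr rfl fun i _ => ?_
  rw [mconvLeft_smul_dirac _ hA, mconvLeft_smul_dirac _ hA, ← sub_mul, hmax]
  rfl

/-- The character `σ_J` evaluated at the sign vector of `b`. -/
def signChar {n : ℕ} (J : Finset (Fin n)) (b : Fin n → Bool) : ℝ :=
  ∏ j ∈ J, (if b j then (1 : ℝ) else -1)

lemma mconv_deltaJ {n : ℕ} (J : Finset (Fin n)) (ν : SM n) :
    mconv (deltaJ J) ν =
      ((2 : ℝ) ^ n)⁻¹ • ∑ b : Fin n → Bool, signChar J b • ν.map (signVec b * ·) := by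
  simp only [deltaJ, Finset.smul_sum, smul_smul]
  exact mconv_sum_smul_dirac (fun b => ((2 : ℝ) ^ n)⁻¹ * signChar J b) signVec ν

lemma mconv_deltaJ_smul {n : ℕ} (J : Finset (Fin n)) (c : ℝ) (ν : SM n) :
    mconv (deltaJ J) (c • ν) = c • mconv (deltaJ J) ν := by
  simp only [mconv_deltaJ, VectorMeasure.map_smul, Finset.smul_sum, smul_smul]
  refine Finset.sum_congr rfl fun b _ => ?_
  congr 1
  ring

lemma sum_signChar {n : ℕ} (b : Fin n → Bool) :
    ∑ J : Finset (Fin n), signChar J b = if b = (fun _ => true) then (2 : ℝ) ^ n else 0 := by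
  have h : ∑ J : Finset (Fin n), signChar J b = ∏ j, (1 + if b j then (1 : ℝ) else -1) := by
    rw [Finset.prod_one_add, Finset.powerset_univ]
    rfl
  rw [h]
  split_ifs with hb
  · subst hb
    norm_num
  · obtain ⟨j, hj⟩ := Function.ne_iff.mp hb
    exact Finset.prod_eq_zero (Finset.mem_univ j) (by simp_all)

lemma sum_mconv_deltaJ {n : ℕ} (ν : SM n) : ∑ J, mconv (deltaJ J) ν = ν := by
  have h1 : (fun x : Fin n → ℝ => signVec (fun _ => true) * x) = id := by
    funext x i
    simp [signVec]
  simp_rw [mconv_deltaJ]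
  rw [← Finset.smul_sum, Finset.sum_comm]
  simp_rw [← Finset.sum_smul, sum_signChar, ite_smul, zero_smul]
  rw [Finset.sum_ite_eq' Finset.univ (fun _ => true), if_pos (Finset.mem_univ _), h1,
    VectorMeasure.map_id, smul_smul, inv_mul_cancel₀ (by positivity), one_smul]

/-- Flip the Boolean signs indexed by `F`. -/
def flipBool {n : ℕ} (F : Finset (Fin n)) (b : Fin n → Bool) : Fin n → Bool :=
  fun i => if i ∈ F then !b i else b i

lemma flipBool_involutive {n : ℕ} (F : Finset (Fin n)) : Function.Involutive (flipBool F) := by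
  intro b
  funext i
  by_cases h : i ∈ F <;> simp [flipBool, h]

lemma signChar_flipBool {n : ℕ} (F J : Finset (Fin n)) (b : Fin n → Bool) :
    signChar J (flipBool F b) = (-1) ^ (J ∩ F).card * signChar J b := by
  rw [← Finset.filter_mem_eq_inter, ← Finset.prod_const, Finset.prod_filter, signChar, signChar,
    ← Finset.prod_mul_distrib]
  refine Finset.prod_congr rfl fun i _ => ?_
  by_cases h : i ∈ F <;> cases hb : b i <;> simp [flipBool, h, hb]

lemma map_signVec_Tmap {n : ℕ} (F : Finset (Fin n)) (b : Fin n → Bool) (ν : SM n) :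
    (Tmap F ν).map (signVec b * ·) = ν.map (signVec (flipBool F b) * ·) := by
  have hs (s : Fin n → ℝ) : Measurable (fun x : Fin n → ℝ => s * x) := by fun_prop
  have hF : Measurable (flipE F) := by
    refine measurable_pi_lambda _ fun i => ?_
    by_cases h : i ∈ F <;> simp only [flipE, h, if_true, if_false] <;> fun_prop
  ext A hA
  rw [VectorMeasure.map_apply _ (hs _) hA, Tmap, VectorMeasure.map_apply _ hF (hs _ hA),
    VectorMeasure.map_apply _ (hs _) hA, ← Set.preimage_comp]
  congr 2
  funext x i
  by_cases h : i ∈ F <;> cases hb : b i <;> simp [flipBool, flipE, signVec, h, hb]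

lemma mconv_deltaJ_Tmap {n : ℕ} (F J : Finset (Fin n)) (ν : SM n) :
    mconv (deltaJ J) (Tmap F ν) = (-1 : ℝ) ^ (J ∩ F).card • mconv (deltaJ J) ν := by
  rw [mconv_deltaJ, mconv_deltaJ, smul_comm]
  congr 1
  rw [← Equiv.sum_comp (flipBool_involutive F).toPerm, Finset.smul_sum]
  refine Finset.sum_congr rfl fun b _ => ?_
  rw [Function.Involutive.coe_toPerm, map_signVec_Tmap, flipBool_involutive F b,
    signChar_flipBool, smul_smul]

lemma Tmap_eq_smul_iff {n : ℕ} (F : Finset (Fin n)) (ν : SM n) (c : ℝ) :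
    Tmap F ν = c • ν ↔
      ∀ J : Finset (Fin n), (-1 : ℝ) ^ (J ∩ F).card ≠ c → mconv (deltaJ J) ν = 0 := by
  constructor
  · intro h J hJ
    have h1 := mconv_deltaJ_Tmap F J ν
    rw [h, mconv_deltaJ_smul] at h1
    ext A _
    have h2 : c * mconv (deltaJ J) ν A = (-1 : ℝ) ^ (J ∩ F).card * mconv (deltaJ J) ν A :=
      congrArg (fun μ : SM n => μ A) h1
    by_contra h0
    exact hJ (mul_right_cancel₀ h0 h2).symm
  · intro h
    rw [← sum_mconv_deltaJ (Tmap F ν)]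
    conv_rhs => rw [← sum_mconv_deltaJ ν, Finset.smul_sum]
    refine Finset.sum_congr rfl fun J _ => ?_
    rw [mconv_deltaJ_Tmap]
    by_cases hJ : (-1 : ℝ) ^ (J ∩ F).card = c
    · rw [hJ]
    · rw [h J hJ, smul_zero, smul_zero]

/-- Theorem: `T_F(ν) = ν` iff `δ_J ⊛ ν = 0` for all `J` with `|J ∩ F|` odd, and
`T_F(ν) = -ν` iff `δ_J ⊛ ν = 0` for all `J` with `|J ∩ F|` even. -/
theorem stmt8 {n : ℕ} (hn : 1 ≤ n) (ν : SM n) (F : Finset (Fin n)) :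
    (Tmap F ν = ν ↔
      ∀ J : Finset (Fin n), Odd (J ∩ F).card → mconv (deltaJ J) ν = 0) ∧
    (Tmap F ν = -ν ↔
      ∀ J : Finset (Fin n), Even (J ∩ F).card → mconv (deltaJ J) ν = 0) := by
  constructor
  · have h1 := Tmap_eq_smul_iff F ν 1
    rw [one_smul] at h1
    refine h1.trans <| forall_congr' fun J => imp_congr_left ?_
    rcases Nat.even_or_odd (J ∩ F).card with h | h
    · simp [h.neg_one_pow, h]
    · norm_num [h.neg_one_pow, h]
  · have h1 := Tmap_eq_smul_iff F ν (-1)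
    have hneg : (-1 : ℝ) • ν = -ν := by
      ext A _
      exact neg_one_mul (ν A)
    rw [hneg] at h1
    refine h1.trans <| forall_congr' fun J => imp_congr_left ?_
    rcases Nat.even_or_odd (J ∩ F).card with h | h
    · norm_num [h.neg_one_pow, h]
    · simp [h.neg_one_pow, h]

end
end

section
/- Let n ≥ 2 and let μ be a finite signed Borel measure on the unit sphere S^{n−1} that is unconditional (invariant under every coordinate sign flip T_E, E ⊆ [n]) and concentrated on B_{[n]} = {u ∈ S^{n−1} : u_i ≠ 0 for all i}. If there is a non-empty relatively open subset U of the simplex Δⁿ = {α ∈ ℝⁿ : α_i ≥ 0 for all i, Σ_i α_i = 1} such that ∫_{S^{n−1}} [v]^α μ(dv) = 0 for all α ∈ U, then μ = 0. -/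
open MeasureTheory
open scoped ENNReal symmDiff Classical

noncomputable section

/-- Two complex moment-generating functions agree on a vertical strip around the imaginary axis
as soon as the real ones are finite and agree on its real trace. -/
lemma eqOn_complexMGF_of_mgf_eqOn {Ω Ω' : Type*} {mΩ : MeasurableSpace Ω}
    {mΩ' : MeasurableSpace Ω'} {μ : Measure Ω} {ν : Measure Ω'} {X : Ω → ℝ} {Y : Ω' → ℝ} {ε : ℝ}
    (hε : 0 < ε)
    (hX : Set.Ioo (-ε) ε ⊆ ProbabilityTheory.integrableExpSet X μ)
    (hY : Set.Ioo (-ε) ε ⊆ ProbabilityTheory.integrableExpSet Y ν)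
    (hXY : Set.EqOn (ProbabilityTheory.mgf X μ) (ProbabilityTheory.mgf Y ν) (Set.Ioo (-ε) ε)) :
    Set.EqOn (ProbabilityTheory.complexMGF X μ) (ProbabilityTheory.complexMGF Y ν)
      {z | z.re ∈ Set.Ioo (-ε) ε} := by
  have hX' : AnalyticOnNhd ℂ (ProbabilityTheory.complexMGF X μ) {z | z.re ∈ Set.Ioo (-ε) ε} :=
    ProbabilityTheory.analyticOnNhd_complexMGF.mono
      fun z hz ↦ interior_maximal hX isOpen_Ioo hz
  have hY' : AnalyticOnNhd ℂ (ProbabilityTheory.complexMGF Y ν) {z | z.re ∈ Set.Ioo (-ε) ε} :=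
    ProbabilityTheory.analyticOnNhd_complexMGF.mono
      fun z hz ↦ interior_maximal hY isOpen_Ioo hz
  refine AnalyticOnNhd.eqOn_of_preconnected_of_frequently_eq hX' hY'
    ((convex_Ioo (-ε) ε).linear_preimage Complex.reLm).isPreconnected (z₀ := 0)
    (by simp [hε]) ?_
  have h_ofReal : Filter.Tendsto ((↑) : ℝ → ℂ) (nhdsWithin 0 {0}ᶜ) (nhdsWithin 0 {0}ᶜ) := by
    refine tendsto_nhdsWithin_iff.2 ⟨?_, ?_⟩
    · exact (Complex.continuous_ofReal.tendsto' 0 0 (by simp)).mono_left nhdsWithin_le_nhds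
    · filter_upwards [self_mem_nhdsWithin] with x hx
      simpa using hx
  refine h_ofReal.frequently (Filter.Eventually.frequently ?_)
  filter_upwards [nhdsWithin_le_nhds (Ioo_mem_nhds (neg_neg_of_pos hε) hε)] with x hx
  rw [ProbabilityTheory.complexMGF_ofReal, ProbabilityTheory.complexMGF_ofReal, hXY hx]

/-- A non-empty relatively open subset of the simplex contains a point with positive
coordinates. -/
lemma exists_pos_mem_of_isOpen {n : ℕ} {V : Set (Fin n → ℝ)} (hV : IsOpen V)
    (hne : (V ∩ {α | (∀ i, 0 ≤ α i) ∧ ∑ i, α i = 1}).Nonempty) :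
    ∃ a ∈ V, (∀ i, 0 < a i) ∧ ∑ i, a i = 1 := by
  obtain ⟨b, hbV, hb0, hb1⟩ := hne
  have hn : (n : ℝ) ≠ 0 := by
    rintro h
    obtain rfl : n = 0 := by exact_mod_cast h
    simp at hb1
  have hn' : 0 < (n : ℝ) := lt_of_le_of_ne n.cast_nonneg hn.symm
  have hcont : Continuous fun s : ℝ ↦ fun i ↦ (1 - s) * b i + s * (n : ℝ)⁻¹ := by fun_prop
  have hev : ∀ᶠ s : ℝ in nhds 0, (fun i ↦ (1 - s) * b i + s * (n : ℝ)⁻¹) ∈ V :=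
    hcont.continuousAt.eventually (hV.mem_nhds (by simpa using hbV))
  have hev' := hev.filter_mono (nhdsWithin_le_nhds (s := Set.Ioi (0 : ℝ)))
  obtain ⟨s, hsV, hs0, hs1⟩ := (hev'.and (Ioo_mem_nhdsGT (zero_lt_one (α := ℝ)))).exists
  refine ⟨_, hsV, fun i ↦ ?_, ?_⟩
  · have := mul_nonneg (sub_nonneg.2 hs1.le) (hb0 i)
    positivity
  · rw [Finset.sum_add_distrib, ← Finset.mul_sum, hb1]
    simp only [Finset.sum_const, Finset.card_univ, Fintype.card_fin, nsmul_eq_mul]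
    field_simp
    ring

/-- From a point of the simplex with positive coordinates one can move a little in every
direction parallel to the simplex. -/
lemma exists_line_mem {n : ℕ} {V : Set (Fin n → ℝ)} (hV : IsOpen V) {a t : Fin n → ℝ}
    (haV : a ∈ V) (ha : ∀ i, 0 < a i) (ha1 : ∑ i, a i = 1) (ht : ∑ i, t i = 0) :
    ∃ ε > (0 : ℝ), ∀ s ∈ Set.Ioo (-ε) ε,
      a + s • t ∈ V ∩ {α | (∀ i, 0 ≤ α i) ∧ ∑ i, α i = 1} := by
  have hcont : Continuous fun s : ℝ ↦ a + s • t := by fun_prop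
  have hpos : IsOpen {α : Fin n → ℝ | ∀ i, 0 < α i} := by
    simp only [Set.ofPred_forall]
    exact isOpen_iInter_of_finite fun i ↦ isOpen_lt continuous_const (continuous_apply i)
  have hev : ∀ᶠ s : ℝ in nhds 0, a + s • t ∈ V ∩ {α : Fin n → ℝ | ∀ i, 0 < α i} :=
    hcont.continuousAt.eventually ((hV.inter hpos).mem_nhds (by simpa using ⟨haV, ha⟩))
  obtain ⟨ε, hε, h⟩ := Metric.eventually_nhds_iff.1 hev
  refine ⟨ε, hε, fun s hs ↦ ?_⟩
  obtain ⟨h1, h2⟩ := h (y := s) (by simpa [abs_lt] using hs)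
  refine ⟨h1, fun i ↦ (h2 i).le, ?_⟩
  simp [Finset.sum_add_distrib, ← Finset.mul_sum, ha1, ht]

/-- The monomial `[v]^α`. -/
def absMonomial {n : ℕ} (α v : Fin n → ℝ) : ℝ := ∏ j, |v j| ^ α j

lemma measurable_absMonomial {n : ℕ} (α : Fin n → ℝ) : Measurable (absMonomial α) := by
  unfold absMonomial
  fun_prop

lemma absMonomial_nonneg {n : ℕ} (α v : Fin n → ℝ) : 0 ≤ absMonomial α v :=
  Finset.prod_nonneg fun _ _ ↦ Real.rpow_nonneg (abs_nonneg _) _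

lemma absMonomial_pos {n : ℕ} (α : Fin n → ℝ) {v : Fin n → ℝ} (hv : ∀ i, v i ≠ 0) :
    0 < absMonomial α v :=
  Finset.prod_pos fun i _ ↦ Real.rpow_pos_of_pos (abs_pos.2 (hv i)) _

lemma absMonomial_abs {n : ℕ} (α v : Fin n → ℝ) : absMonomial α |v| = absMonomial α v := by
  simp [absMonomial]

lemma absMonomial_add_smul {n : ℕ} (a t : Fin n → ℝ) (s : ℝ) {v : Fin n → ℝ}
    (hv : ∀ i, v i ≠ 0) :
    absMonomial (a + s • t) v = absMonomial a v * Real.exp (s * ∑ j, t j * Real.log |v j|) := by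
  rw [Finset.mul_sum, Real.exp_sum, absMonomial, absMonomial, ← Finset.prod_mul_distrib]
  refine Finset.prod_congr rfl fun j _ ↦ ?_
  have := abs_pos.2 (hv j)
  simp only [Pi.add_apply, Pi.smul_apply, smul_eq_mul]
  rw [Real.rpow_add this, Real.rpow_def_of_pos this (s * t j)]
  ring_nf

lemma abs_le_one_of_mem_Sph {n : ℕ} {v : Fin n → ℝ} (hv : v ∈ Sph n) (i : Fin n) :
    |v i| ≤ 1 := by
  have h : ∑ i, v i ^ 2 = 1 := Real.sqrt_eq_one.1 hv
  have := Finset.single_le_sum (f := fun i ↦ v i ^ 2) (fun i _ ↦ sq_nonneg _) (Finset.mem_univ i)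
  exact abs_le_one_iff_mul_self_le_one.2 (by nlinarith)

lemma absMonomial_le_one {n : ℕ} {α v : Fin n → ℝ} (hα : ∀ i, 0 ≤ α i) (hv : v ∈ Sph n) :
    absMonomial α v ≤ 1 :=
  Finset.prod_le_one (fun _ _ ↦ Real.rpow_nonneg (abs_nonneg _) _) fun i _ ↦
    Real.rpow_le_one (abs_nonneg _) (abs_le_one_of_mem_Sph hv i) (hα i)

lemma integrable_absMonomial {n : ℕ} {p : Measure (Fin n → ℝ)} [IsFiniteMeasure p]
    (hp : ∀ᵐ v ∂p, v ∈ Sph n) {α : Fin n → ℝ} (hα : ∀ i, 0 ≤ α i) :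
    Integrable (absMonomial α) p := by
  refine Integrable.of_bound (measurable_absMonomial α).aestronglyMeasurable 1 ?_
  filter_upwards [hp] with v hv
  rw [Real.norm_of_nonneg (absMonomial_nonneg α v)]
  exact absMonomial_le_one hα hv

/-- The measure with density `[v]^α` with respect to `p`. -/
def tilt {n : ℕ} (α : Fin n → ℝ) (p : Measure (Fin n → ℝ)) : Measure (Fin n → ℝ) :=
  p.withDensity fun v ↦ ENNReal.ofReal (absMonomial α v)

lemma measurable_ofReal_absMonomial {n : ℕ} (α : Fin n → ℝ) :
    Measurable fun v ↦ ENNReal.ofReal (absMonomial α v) :=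
  (measurable_absMonomial α).ennreal_ofReal

lemma integrable_exp_tilt {n : ℕ} {p : Measure (Fin n → ℝ)} [IsFiniteMeasure p]
    (hp : ∀ᵐ v ∂p, (∀ i, v i ≠ 0) ∧ v ∈ Sph n) {a t : Fin n → ℝ} {s : ℝ}
    (h0 : ∀ i, 0 ≤ (a + s • t) i) :
    Integrable (fun v ↦ Real.exp (s * ∑ j, t j * Real.log |v j|)) (tilt a p) := by
  rw [tilt, integrable_withDensity_iff_integrable_smul' (measurable_ofReal_absMonomial a)
    (by simp)]
  refine (integrable_absMonomial (hp.mono fun v hv ↦ hv.2) h0).congr ?_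
  filter_upwards [hp] with v hv
  rw [absMonomial_add_smul a t s hv.1, ENNReal.toReal_ofReal (absMonomial_nonneg a v), smul_eq_mul]

lemma mgf_tilt {n : ℕ} {p : Measure (Fin n → ℝ)}
    (hp : ∀ᵐ v ∂p, ∀ i, v i ≠ 0) (a t : Fin n → ℝ) (s : ℝ) :
    ProbabilityTheory.mgf (fun v ↦ ∑ j, t j * Real.log |v j|) (tilt a p) s
      = ∫ v, absMonomial (a + s • t) v ∂p := by
  rw [ProbabilityTheory.mgf, tilt,
    integral_withDensity_eq_integral_toReal_smul (measurable_ofReal_absMonomial a) (by simp)]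
  refine integral_congr_ae ?_
  filter_upwards [hp] with v hv
  rw [absMonomial_add_smul a t s hv, ENNReal.toReal_ofReal (absMonomial_nonneg a v), smul_eq_mul]

lemma isFiniteMeasure_tilt {n : ℕ} {p : Measure (Fin n → ℝ)} [IsFiniteMeasure p]
    (hp : ∀ᵐ v ∂p, v ∈ Sph n) {α : Fin n → ℝ} (hα : ∀ i, 0 ≤ α i) :
    IsFiniteMeasure (tilt α p) :=
  isFiniteMeasure_withDensity_ofReal (integrable_absMonomial hp hα).hasFiniteIntegral

/-- The centred logarithmic coordinates of `v`. -/
def centredLog {n : ℕ} (v : Fin n → ℝ) : Fin n → ℝ :=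
  fun j ↦ Real.log |v j| - (∑ k, Real.log |v k|) / n

/-- The inverse of `centredLog` on the positive part of the sphere. -/
def expNormalize {n : ℕ} (w : Fin n → ℝ) : Fin n → ℝ :=
  fun j ↦ Real.exp (w j) / e2 fun k ↦ Real.exp (w k)

lemma measurable_centredLog {n : ℕ} : Measurable (centredLog (n := n)) := by
  unfold centredLog
  fun_prop

lemma measurable_expNormalize {n : ℕ} : Measurable (expNormalize (n := n)) := by
  unfold expNormalize e2
  fun_prop

lemma e2_mul_const {n : ℕ} {c : ℝ} (hc : 0 ≤ c) (v : Fin n → ℝ) :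
    e2 (fun k ↦ v k * c) = e2 v * c := by
  simp only [e2, mul_pow, ← Finset.sum_mul]
  rw [Real.sqrt_mul (by positivity), Real.sqrt_sq hc]

lemma expNormalize_centredLog {n : ℕ} {v : Fin n → ℝ} (hv : ∀ i, v i ≠ 0) (hS : v ∈ Sph n) :
    expNormalize (centredLog v) = |v| := by
  have hexp (j) : Real.exp (centredLog v j)
      = |v| j * Real.exp (-((∑ k, Real.log |v k|) / n)) := by
    rw [centredLog, sub_eq_add_neg, Real.exp_add, Real.exp_log (abs_pos.2 (hv j)), Pi.abs_apply]
  have habs : e2 |v| = 1 := by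
    rw [← show e2 v = 1 from hS]
    simp [e2]
  ext j
  simp only [expNormalize, hexp]
  rw [e2_mul_const (Real.exp_nonneg _), habs, one_mul, mul_div_cancel_right₀ _ (Real.exp_ne_zero _)]

lemma exists_apply_centredLog {n : ℕ} (hn : n ≠ 0) (L : StrongDual ℝ (Fin n → ℝ)) :
    ∃ t : Fin n → ℝ, ∑ i, t i = 0 ∧ ∀ v, L (centredLog v) = ∑ j, t j * Real.log |v j| := by
  have hn' : (n : ℝ) ≠ 0 := by exact_mod_cast hn
  set c : Fin n → ℝ := fun i ↦ L (Pi.single i 1) with hc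
  refine ⟨fun j ↦ c j - (∑ k, c k) / n, ?_, fun v ↦ ?_⟩
  · simp only [Finset.sum_sub_distrib, Finset.sum_const, Finset.card_univ, Fintype.card_fin,
      nsmul_eq_mul]
    field_simp
    ring
  · have hL : L (centredLog v) = ∑ i, centredLog v i * c i := by
      conv_lhs => rw [pi_eq_sum_univ' (centredLog v)]
      simp [hc, map_sum]
    rw [hL]
    simp only [centredLog, sub_mul, Finset.sum_sub_distrib, ← Finset.mul_sum]
    rw [Finset.sum_congr rfl fun i _ ↦ mul_comm (Real.log |v i|) (c i)]
    ring

lemma measurable_pi_abs (n : ℕ) : Measurable fun v : Fin n → ℝ ↦ |v| :=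
  measurable_pi_lambda _ fun i ↦ (measurable_pi_apply i).abs

/-- The moments on a relatively open subset of the simplex determine the image under `|·|` of a
finite measure on the sphere which does not charge the coordinate hyperplanes. -/
lemma map_abs_eq_of_moments {n : ℕ} {p q : Measure (Fin n → ℝ)} [IsFiniteMeasure p]
    [IsFiniteMeasure q] (hp : ∀ᵐ v ∂p, (∀ i, v i ≠ 0) ∧ v ∈ Sph n)
    (hq : ∀ᵐ v ∂q, (∀ i, v i ≠ 0) ∧ v ∈ Sph n) {V : Set (Fin n → ℝ)} (hV : IsOpen V)
    (hne : (V ∩ {α | (∀ i, 0 ≤ α i) ∧ ∑ i, α i = 1}).Nonempty)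
    (h : ∀ α ∈ V ∩ {α | (∀ i, 0 ≤ α i) ∧ ∑ i, α i = 1},
      ∫ v, absMonomial α v ∂p = ∫ v, absMonomial α v ∂q) :
    p.map (fun v ↦ |v|) = q.map (fun v ↦ |v|) := by
  obtain ⟨a, haV, ha, ha1⟩ := exists_pos_mem_of_isOpen hV hne
  have hn : n ≠ 0 := by
    rintro rfl
    simp at ha1
  have := isFiniteMeasure_tilt (hp.mono fun v hv ↦ hv.2) fun i ↦ (ha i).le
  have := isFiniteMeasure_tilt (hq.mono fun v hv ↦ hv.2) fun i ↦ (ha i).le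
  have habs := measurable_pi_abs n
  have hlog : (tilt a p).map centredLog = (tilt a q).map centredLog := by
    refine Measure.ext_of_charFunDual (funext fun L ↦ ?_)
    obtain ⟨t, ht, hL⟩ := exists_apply_centredLog hn L
    obtain ⟨ε, hε, hline⟩ := exists_line_mem hV haV ha ha1 ht
    have key := eqOn_complexMGF_of_mgf_eqOn (μ := tilt a p) (ν := tilt a q)
      (X := fun v ↦ ∑ j, t j * Real.log |v j|) (Y := fun v ↦ ∑ j, t j * Real.log |v j|) hε
      (fun s hs ↦ integrable_exp_tilt hp (hline s hs).2.1)
      (fun s hs ↦ integrable_exp_tilt hq (hline s hs).2.1)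
      (fun s hs ↦ by
        rw [mgf_tilt (hp.mono fun v hv ↦ hv.1), mgf_tilt (hq.mono fun v hv ↦ hv.1)]
        exact h _ (hline s hs))
      (x := Complex.I) (by simp [hε])
    have hchar (r : Measure (Fin n → ℝ)) : charFunDual (r.map centredLog) L
        = ProbabilityTheory.complexMGF (fun v ↦ ∑ j, t j * Real.log |v j|) r Complex.I := by
      rw [charFunDual_apply, integral_map measurable_centredLog.aemeasurable
        (Measurable.aestronglyMeasurable (by fun_prop)), ProbabilityTheory.complexMGF]
      simp only [hL, mul_comm]
    rw [hchar, hchar, key]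
  have hmap {r : Measure (Fin n → ℝ)} (hr : ∀ᵐ v ∂r, (∀ i, v i ≠ 0) ∧ v ∈ Sph n) :
      (tilt a r).map (fun v ↦ |v|) = ((tilt a r).map centredLog).map expNormalize := by
    rw [Measure.map_map measurable_expNormalize measurable_centredLog]
    refine Measure.map_congr ?_
    filter_upwards [withDensity_absolutelyContinuous _ _ |>.ae_le hr] with v hv
    exact (expNormalize_centredLog hv.1 hv.2).symm
  have hrec {r : Measure (Fin n → ℝ)} (hr : ∀ᵐ v ∂r, (∀ i, v i ≠ 0) ∧ v ∈ Sph n) :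
      r.map (fun v ↦ |v|) = ((tilt a r).map (fun v ↦ |v|)).withDensity
        fun v ↦ (ENNReal.ofReal (absMonomial a v))⁻¹ := by
    have hinv : (tilt a r).withDensity (fun v ↦ (ENNReal.ofReal (absMonomial a v))⁻¹) = r :=
      withDensity_inv_same (measurable_ofReal_absMonomial a)
        (hr.mono fun v hv ↦ by simpa using absMonomial_pos a hv.1) (by simp)
    ext A hA
    rw [Measure.map_apply habs hA, withDensity_apply _ hA,
      setLIntegral_map hA (measurable_ofReal_absMonomial a).fun_inv habs]
    conv_lhs => rw [← hinv, withDensity_apply _ (habs hA)]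
    simp only [absMonomial_abs]
  rw [hrec hp, hrec hq, hmap hp, hmap hq, hlog]

lemma measurable_flipE {n : ℕ} (E : Finset (Fin n)) : Measurable (flipE E) := by
  refine measurable_pi_lambda _ fun i ↦ ?_
  unfold flipE
  split_ifs <;> fun_prop

lemma flipE_flipE {n : ℕ} (E F : Finset (Fin n)) (v : Fin n → ℝ) :
    flipE E (flipE F v) = flipE (E ∆ F) v := by
  ext i
  by_cases hE : i ∈ E <;> by_cases hF : i ∈ F <;> simp [flipE, hE, hF, Finset.mem_symmDiff]

lemma exists_flipE_eq_abs {n : ℕ} (v : Fin n → ℝ) : ∃ F, flipE F v = |v| := by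
  refine ⟨Finset.univ.filter fun i ↦ v i < 0, ?_⟩
  ext i
  by_cases h : v i < 0
  · simp [flipE, h, abs_of_neg h]
  · simp [flipE, h, abs_of_nonneg (not_lt.1 h)]

lemma sum_comp_flipE_abs {n : ℕ} {M : Type*} [AddCommMonoid M] (f : (Fin n → ℝ) → M)
    (v : Fin n → ℝ) :
    ∑ E, f (flipE E |v|) = ∑ E, f (flipE E v) := by
  obtain ⟨F, hF⟩ := exists_flipE_eq_abs v
  refine Fintype.sum_bijective (· ∆ F) (symmDiff_left_involutive F).bijective _ _ fun E ↦ ?_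
  rw [← hF, flipE_flipE]

lemma sum_preimage_flipE {n : ℕ} (p : Measure (Fin n → ℝ)) {A : Set (Fin n → ℝ)}
    (hA : MeasurableSet A) :
    ∑ E, p (flipE E ⁻¹' A) = ∑ E, p.map (fun v ↦ |v|) (flipE E ⁻¹' A) := by
  have habs := measurable_pi_abs n
  have hind : Measurable (A.indicator fun _ ↦ (1 : ℝ≥0∞)) := measurable_const.indicator hA
  have hcomp (E : Finset (Fin n)) :
      Measurable fun v ↦ A.indicator (fun _ ↦ (1 : ℝ≥0∞)) (flipE E v) :=
    hind.comp (measurable_flipE E)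
  have hint (r : Measure (Fin n → ℝ)) :
      ∑ E, r (flipE E ⁻¹' A) = ∫⁻ v, ∑ E, A.indicator (fun _ ↦ 1) (flipE E v) ∂r := by
    rw [lintegral_finsetSum _ fun E _ ↦ hcomp E]
    refine Finset.sum_congr rfl fun E _ ↦ ?_
    rw [← lintegral_indicator_one (measurable_flipE E hA)]
    rfl
  rw [hint, hint, lintegral_map (Finset.measurable_fun_sum _ fun E _ ↦ hcomp E) habs]
  simp only [sum_comp_flipE_abs]

/-- Theorem: an unconditional signed measure on `S^{n-1}` concentrated on `B_{[n]}` whose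
moments `∫ [v]^α dμ` vanish on a non-empty relatively open subset of the simplex `Δⁿ`
is zero (n ≥ 2). -/
theorem stmt11 {n : ℕ} (hn : 2 ≤ n) (μ : SM n)
    (hconc : ConcOn μ (setA (Finset.univ : Finset (Fin n)) ∩ Sph n))
    (hunc : ∀ E : Finset (Fin n), Tmap E μ = μ)
    (U : Set (Fin n → ℝ))
    (hUopen : ∃ V : Set (Fin n → ℝ), IsOpen V ∧
      U = V ∩ {α | (∀ i, 0 ≤ α i) ∧ ∑ i, α i = 1})
    (hUne : U.Nonempty)
    (h : ∀ α ∈ U, sInt μ (fun v => ∏ j, |v j| ^ (α j)) = 0) :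
    μ = 0 := by
  obtain ⟨V, hV, rfl⟩ := hUopen
  set p := μ.toJordanDecomposition.posPart
  set q := μ.toJordanDecomposition.negPart
  have hmem {v : Fin n → ℝ} (hv : v ∈ setA (Finset.univ : Finset (Fin n)) ∩ Sph n) :
      (∀ i, v i ≠ 0) ∧ v ∈ Sph n :=
    ⟨fun i ↦ (hv.1 i).2 (Finset.mem_univ i), hv.2⟩
  have hconc' : p _ = 0 ∧ q _ = 0 := add_eq_zero.1 hconc
  have hp : ∀ᵐ v ∂p, (∀ i, v i ≠ 0) ∧ v ∈ Sph n :=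
    Filter.Eventually.mono (mem_ae_iff.2 hconc'.1) fun v hv ↦ hmem hv
  have hq : ∀ᵐ v ∂q, (∀ i, v i ≠ 0) ∧ v ∈ Sph n :=
    Filter.Eventually.mono (mem_ae_iff.2 hconc'.2) fun v hv ↦ hmem hv
  have habs := map_abs_eq_of_moments hp hq hV hUne fun α hα ↦ sub_eq_zero.1 (h α hα)
  ext A hA
  have hflip (E : Finset (Fin n)) :
      μ A = p.real (flipE E ⁻¹' A) - q.real (flipE E ⁻¹' A) := by
    rw [← SignedMeasure.apply_eq_posPart_real_sub_negPart_real _ (measurable_flipE E hA),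
      ← VectorMeasure.map_apply _ (measurable_flipE E) hA]
    exact congrArg (fun ν : SM n ↦ ν A) (hunc E).symm
  have hsum : ∑ E, p.real (flipE E ⁻¹' A) = ∑ E, q.real (flipE E ⁻¹' A) := by
    simp only [measureReal_def]
    rw [← ENNReal.toReal_sum fun _ _ ↦ measure_ne_top _ _,
      ← ENNReal.toReal_sum fun _ _ ↦ measure_ne_top _ _,
      sum_preimage_flipE p hA, sum_preimage_flipE q hA, habs]
  have hcard : ∑ _E : Finset (Fin n), μ A = 0 := by
    rw [Finset.sum_congr rfl fun E _ ↦ hflip E, Finset.sum_sub_distrib, hsum, sub_self]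
  simpa using hcard

end
end
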